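/- arXiv:1712.09145 — 2 statements merged into one kernel-verified Lean document; each statement's English description precedes it below -/
import Mathlib

section
/- Anonymity identity of the CL-Ring scheme: Let n be a positive natural number, s : Fin n, and let κ, x_s : ZMod q, scalars r, h : Fin n → ZMod q, and elements Q : Fin n → G₁, Pk : Fin n → G₁, U : G₁ with P₀ = κ•P, Pk s = x_s•P and D_s = κ•(Q s). Define y : Fin n → G₂ by y i = e((r i)•P, P) for i ≠ s and y s = e((r s)•P, P) · e(-P₀, ∑_{i ≠ s} (h i)•(Q i)) · e(-U, ∑_{i ≠ s} (h i)•(Pk i)), and set V = (∑ i, r i)•P + (h s)•(D_s + x_s•U). Then for EVERY index j : Fin n (not only the actual signer s) one has e(V, P) = (∏ i, y i) · e(P₀, ∑_{i ≠ j} (h i)•(Q i)) · e(U, ∑_{i ≠ j} (h i)•(Pk i)) · e((h j)•(Q j), P₀) · e((h j)•(Pk j), U); consequently the element V of the signature satisfies, for every ring member j, the same relation that it satisfies for the actual signer, so V does not single out the actual signer. -/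
theorem clring_anonymity
    {q : ℕ} [Fact (Nat.Prime q)]
    {G₁ : Type*} [AddCommGroup G₁] [Module (ZMod q) G₁]
    {G₂ : Type*} [CommGroup G₂]
    (P : G₁) (e : G₁ → G₁ → G₂)
    (e_add_left : ∀ x y z : G₁, e (x + y) z = e x z * e y z)
    (e_add_right : ∀ x y z : G₁, e x (y + z) = e x y * e x z)
    (e_smul : ∀ (a : ZMod q) (x y : G₁), e (a • x) y = e x (a • y))
    (e_symm : ∀ x y : G₁, e x y = e y x)
    (n : ℕ) (hn : 0 < n) (s : Fin n)
    (κ x_s : ZMod q) (r h : Fin n → ZMod q)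
    (Q Pk : Fin n → G₁) (U P₀ D_s : G₁)
    (hP₀ : P₀ = κ • P) (hPk : Pk s = x_s • P) (hDs : D_s = κ • Q s)
    (y : Fin n → G₂)
    (hy : ∀ i, i ≠ s → y i = e (r i • P) P)
    (hys : y s = e (r s • P) P
        * e (-P₀) (∑ i ∈ Finset.univ.erase s, h i • Q i)
        * e (-U) (∑ i ∈ Finset.univ.erase s, h i • Pk i))
    (V : G₁) (hV : V = (∑ i, r i) • P + h s • (D_s + x_s • U)) :
    ∀ j : Fin n,
      e V P = (∏ i, y i)
        * e P₀ (∑ i ∈ Finset.univ.erase j, h i • Q i)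
        * e U (∑ i ∈ Finset.univ.erase j, h i • Pk i)
        * e (h j • Q j) P₀ * e (h j • Pk j) U := by
  have e_zero : ∀ z, e 0 z = 1 := by
    intro z
    have := e_add_left 0 0 z
    rw [add_zero] at this
    exact left_eq_mul.mp this
  have e_neg : ∀ x z, e (-x) z = (e x z)⁻¹ := by
    intro x z
    have := e_add_left (-x) x z
    rw [neg_add_cancel, e_zero] at this
    exact eq_inv_of_mul_eq_one_left this.symm
  have key : ∀ (A : G₁) (f : Fin n → G₁) (j : Fin n),
      e A (∑ i ∈ Finset.univ.erase j, f i) * e (f j) A = e A (∑ i, f i) := by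
    intro A f j
    rw [e_symm (f j) A, ← e_add_right, Finset.sum_erase_add _ _ (Finset.mem_univ j)]
  have e_sum : ∀ t : Finset (Fin n), e ((∑ i ∈ t, r i) • P) P = ∏ i ∈ t, e (r i • P) P := by
    intro t
    induction t using Finset.induction_on with
    | empty => simp [e_zero]
    | insert a t ha ih =>
      rw [Finset.sum_insert ha, Finset.prod_insert ha, add_smul, e_add_left, ih]
  have hprod : ∏ i, y i = e ((∑ i, r i) • P) P
      * (e P₀ (∑ i ∈ Finset.univ.erase s, h i • Q i))⁻¹
      * (e U (∑ i ∈ Finset.univ.erase s, h i • Pk i))⁻¹ := by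
    rw [e_sum, ← Finset.mul_prod_erase _ y (Finset.mem_univ s),
      ← Finset.mul_prod_erase _ (fun i => e (r i • P) P) (Finset.mem_univ s), hys, e_neg, e_neg,
      Finset.prod_congr rfl (fun i hi => hy i (Finset.ne_of_mem_erase hi))]
    simp only [mul_comm, mul_left_comm, mul_assoc]
  intro j
  have h1 := key P₀ (fun i => h i • Q i)
  have h2 := key U (fun i => h i • Pk i)
  have hVe : e V P = e ((∑ i, r i) • P) P * (e (h s • Q s) P₀ * e (h s • Pk s) U) := by
    have a1 : e (h s • κ • Q s) P = e (h s • Q s) P₀ := by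
      rw [smul_comm, e_smul, hP₀]
    have a2 : e (h s • x_s • U) P = e (h s • Pk s) U := by
      rw [hPk, e_smul, e_smul, e_symm U, smul_comm x_s (h s)]
    rw [hV, hDs, e_add_left, smul_add, e_add_left, a1, a2]
  have g1 := (h1 s).trans (h1 j).symm
  have g2 := (h2 s).trans (h2 j).symm
  rw [hVe, hprod, eq_inv_mul_of_mul_eq g1, eq_inv_mul_of_mul_eq g2]
  simp only [mul_comm, mul_left_comm, mul_assoc]
end

section
/- CDH extraction, Case 3 of the proof of Theorem 1: Let a, b, α, β, x, h, h' : ZMod q with h ≠ h' and x*β + α ≠ 0, and set P₀ = a•P, Pk_s = x•(a•P), U = β•(b•P), Q_s = α•(b•P). If V, V' : G₁ satisfy e(V - V', P) = e((h - h')•Pk_s, U) · e((h - h')•Q_s, P₀), then (a*b)•P = (x*β + α)⁻¹•((h - h')⁻¹•(V - V')). -/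
theorem clring_cdh_extraction_case3
    {q : ℕ} [Fact (Nat.Prime q)]
    {G₁ : Type*} [AddCommGroup G₁] [Module (ZMod q) G₁]
    {G₂ : Type*} [CommGroup G₂]
    (P : G₁) (e : G₁ → G₁ → G₂)
    (e_add_left : ∀ x y z : G₁, e (x + y) z = e x z * e y z)
    (e_add_right : ∀ x y z : G₁, e x (y + z) = e x y * e x z)
    (e_smul : ∀ (a : ZMod q) (x y : G₁), e (a • x) y = e x (a • y))
    (e_nd : ∀ x : G₁, e x P = 1 → x = 0)
    (a b α β x h h' : ZMod q) (hne : h ≠ h') (hxβα : x * β + α ≠ 0)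
    (P₀ Pk_s U Q_s : G₁)
    (hP₀ : P₀ = a • P) (hPk : Pk_s = x • (a • P)) (hU : U = β • (b • P))
    (hQs : Q_s = α • (b • P))
    (V V' : G₁)
    (heq : e (V - V') P = e ((h - h') • Pk_s) U * e ((h - h') • Q_s) P₀) :
    (a * b) • P = (x * β + α)⁻¹ • ((h - h')⁻¹ • (V - V')) := by
  have hd : h - h' ≠ 0 := sub_ne_zero.mpr hne
  subst hP₀ hPk hU hQs
  rw [← e_smul, ← e_smul, ← e_smul, ← e_add_left] at heq
  have key : V - V' = ((h - h') * (x * β + α) * (a * b)) • P := by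
    have h1 : e (V - V' - ((h - h') * (x * β + α) * (a * b)) • P) P = 1 := by
      have h2 := e_add_left (V - V' - ((h - h') * (x * β + α) * (a * b)) • P)
        (((h - h') * (x * β + α) * (a * b)) • P) P
      rw [sub_add_cancel, heq] at h2
      have h3 : ∀ y z : G₁, y = z → e y P = e z P := fun y z hyz => by rw [hyz]
      rw [h3 _ (((h - h') * (x * β + α) * (a * b)) • P) (by module)] at h2
      exact right_eq_mul.mp h2
    exact sub_eq_zero.mp (e_nd _ h1)
  rw [key, smul_smul, smul_smul]
  congr 1
  field_simp
end
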